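/- Let A be a closable subgroup of a group Γ. Then every clo(A)-admissible element of Γ lies in clo(A). (Here clo(A) is a strongly closable subgroup of Γ, so clo(A)-admissibility is defined.) -/

import Mathlib

/-- The rank of a subgroup, as an extended natural number: the minimal cardinality of a
finite generating set, or `⊤` if the subgroup is not finitely generated. -/
noncomputable def subgroupRank {Γ : Type*} [Group Γ] (H : Subgroup Γ) : ℕ∞ :=
  ⨅ (S : Finset Γ) (_ : Subgroup.closure (S : Set Γ) = H), (S.card : ℕ∞)

/-- `A` has local rank at most `r` if every finitely generated subgroup of `A` is contained
in a subgroup of `A` of rank at most `r`. -/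
def LocalRankLE {Γ : Type*} [Group Γ] (A : Subgroup Γ) (r : ℕ) : Prop :=
  ∀ B : Subgroup Γ, B ≤ A → B.FG →
    ∃ C : Subgroup Γ, C ≤ A ∧ B ≤ C ∧ subgroupRank C ≤ (r : ℕ∞)

/-- The local rank of a subgroup: the least `r` such that `LocalRankLE A r`, or `⊤` if
there is no such `r`. -/
noncomputable def localRank {Γ : Type*} [Group Γ] (A : Subgroup Γ) : ℕ∞ :=
  ⨅ (r : ℕ) (_ : LocalRankLE A r), (r : ℕ∞)

/-- A group is `k`-free if every subgroup of rank at most `k` is free. -/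
def KFree (Γ : Type*) [Group Γ] (k : ℕ) : Prop :=
  ∀ H : Subgroup Γ, subgroupRank H ≤ (k : ℕ∞) → IsFreeGroup H

/-- The index of freedom of `Γ`: the supremum of all `k` such that `Γ` is `k`-free. -/
noncomputable def iof (Γ : Type*) [Group Γ] : ℕ∞ :=
  ⨆ (k : ℕ) (_ : KFree Γ k), (k : ℕ∞)

/-- A subgroup `A` of `Γ` is strongly closable if `localRank A < iof Γ`. -/
def StronglyClosable {Γ : Type*} [Group Γ] (A : Subgroup Γ) : Prop :=
  localRank A < iof Γ

/-- A subgroup `A` of `Γ` is closable if it has finite local rank and there is some `z ∈ Γ`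
with `localRank ⟨A, z⟩ < iof Γ`. -/
def Closable {Γ : Type*} [Group Γ] (A : Subgroup Γ) : Prop :=
  localRank A < ⊤ ∧ ∃ z : Γ, localRank (A ⊔ Subgroup.closure {z}) < iof Γ

/-- An element `x` of `Γ` is `A`-admissible if `⟨A, x⟩` is strongly closable and
`localRank ⟨A, x⟩ ≤ localRank A`. -/
def Admissible {Γ : Type*} [Group Γ] (A : Subgroup Γ) (x : Γ) : Prop :=
  StronglyClosable (A ⊔ Subgroup.closure {x}) ∧
    localRank (A ⊔ Subgroup.closure {x}) ≤ localRank A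

/-- A sequence `x₁, …, x_m` is `A`-admissible if each `x_i` is `⟨A, x₁, …, x_{i-1}⟩`-admissible. -/
def AdmissibleSeq {Γ : Type*} [Group Γ] : Subgroup Γ → List Γ → Prop
  | _, [] => True
  | A, x :: xs => Admissible A x ∧ AdmissibleSeq (A ⊔ Subgroup.closure {x}) xs

/-- `clo A` is the set of all `x ∈ Γ` which occur as the last term of an `A`-admissible
sequence. -/
def clo {Γ : Type*} [Group Γ] (A : Subgroup Γ) : Set Γ :=
  { x | ∃ l : List Γ, AdmissibleSeq A (l ++ [x]) }

/-- The homomorphism `ι_{A,x}` from the free product `A ∗ ⟨t⟩` to `Γ` restricting to the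
inclusion on `A` and sending `t` to `x`. -/
noncomputable def iotaAX {Γ : Type*} [Group Γ] (A : Subgroup Γ) (x : Γ) :
    Monoid.Coprod (↥A) (Multiplicative ℤ) →* Γ :=
  Monoid.Coprod.lift A.subtype (zpowersHom Γ x)

/-- Elements `g 0, …, g (m-1)` of `Γ` are independent if they freely generate a free subgroup,
i.e. the induced homomorphism from the free group on `m` generators is injective. -/
def Independent {Γ : Type*} [Group Γ] {m : ℕ} (g : Fin m → Γ) : Prop :=
  Function.Injective (FreeGroup.lift g : FreeGroup (Fin m) →* Γ)


theorem exists_perm_extend {G : Type*} [Group G] (P : Set G) [Finite P] (a : G) :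
    ∃ σ : Equiv.Perm P, ∀ p : P, ∀ h : a * p ∈ P, σ p = ⟨a * p, h⟩ := by
  classical
  have := Fintype.ofFinite P
  let e : {p : P // a * (p : G) ∈ P} ≃ {q : P // a⁻¹ * (q : G) ∈ P} :=
    { toFun := fun p => ⟨⟨a * p.1, p.2⟩, by simp⟩
      invFun := fun q => ⟨⟨a⁻¹ * q.1, q.2⟩, by simp⟩
      left_inv := fun p => by ext; simp
      right_inv := fun p => by ext; simp }
  refine ⟨e.extendSubtype, fun p h => ?_⟩
  rw [Equiv.extendSubtype_apply_of_mem e p h]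
  rfl

theorem freeGroup_residual {α : Type*} (w : FreeGroup α) (hw : w ≠ 1) :
    ∃ (P : Set (FreeGroup α)) (_ : Finite P) (φ : FreeGroup α →* Equiv.Perm P), φ w ≠ 1 := by
  obtain ⟨L, rfl⟩ : ∃ L, FreeGroup.mk L = w := ⟨_, Quot.out_eq w⟩
  let P : Set (FreeGroup α) := {g | ∃ L', L' <:+ L ∧ FreeGroup.mk L' = g}
  have hP : P.Finite := by
    have : P = FreeGroup.mk '' {L' | L' ∈ L.tails} := by
      ext g; simp [P, List.mem_tails]
    rw [this]
    exact (List.finite_toSet _).image _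
  have : Finite P := hP
  choose σ hσ using fun a : α => exists_perm_extend P (FreeGroup.of a)
  refine ⟨P, this, FreeGroup.lift σ, fun h => hw ?_⟩
  have h1 : (1 : FreeGroup α) ∈ P := ⟨[], List.nil_suffix, rfl⟩
  have key : ∀ L' : List (α × Bool), ∀ h : L' <:+ L,
      FreeGroup.lift σ (FreeGroup.mk L') ⟨1, h1⟩ = ⟨FreeGroup.mk L', ⟨L', h, rfl⟩⟩ := by
    intro L'
    induction L' with
    | nil => intro h; exact congrFun (congrArg DFunLike.coe (map_one (FreeGroup.lift σ))) _
    | cons x xs ih =>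
      intro h
      have hxs : xs <:+ L := (List.suffix_cons x xs).trans h
      have hmk : FreeGroup.mk (x :: xs) = FreeGroup.mk [x] * FreeGroup.mk xs := by
        simp [FreeGroup.mul_mk]
      have hmem : FreeGroup.mk (x :: xs) ∈ P := ⟨_, h, rfl⟩
      have hmem' : FreeGroup.mk xs ∈ P := ⟨_, hxs, rfl⟩
      obtain ⟨a, b⟩ := x
      have e1 : FreeGroup.lift σ (FreeGroup.mk ((a, b) :: xs)) ⟨1, h1⟩
          = FreeGroup.lift σ (FreeGroup.mk [(a, b)]) ⟨FreeGroup.mk xs, hmem'⟩ := by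
        rw [hmk, map_mul, Equiv.Perm.mul_apply, ih hxs]
      rw [e1]
      cases b with
      | true =>
        change FreeGroup.lift σ (FreeGroup.of a) _ = _
        rw [FreeGroup.lift_apply_of]
        exact hσ a ⟨FreeGroup.mk xs, hmem'⟩ hmem
      | false =>
        have e2 : FreeGroup.mk [(a, false)] = (FreeGroup.of a)⁻¹ := by
          rfl
        rw [e2, map_inv, FreeGroup.lift_apply_of, Equiv.Perm.inv_eq_iff_eq]
        have e3 : FreeGroup.of a * FreeGroup.mk ((a, false) :: xs) = FreeGroup.mk xs := by
          rw [hmk, e2, mul_inv_cancel_left]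
        have := hσ a ⟨FreeGroup.mk ((a, false) :: xs), hmem⟩ (by rw [e3]; exact hmem')
        rw [this]
        exact Subtype.ext e3.symm
  have := key L List.suffix_rfl
  rw [h] at this
  exact (congrArg Subtype.val this).symm

theorem hopf_aux {X : Type*} {m : ℕ} (φ : FreeGroup (Fin m) →* FreeGroup X)
    (hφ : Function.Surjective φ) :
    Finite X ∧ Nat.card X ≤ m ∧ (Nat.card X = m → Function.Injective φ) := by
  have inj : ∀ (G : Type _) [Group G], Function.Injective
      (fun f : X → G => fun i : Fin m => FreeGroup.lift f (φ (FreeGroup.of i))) := by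
    intro G _ f g hfg
    have h1 : (FreeGroup.lift f).comp φ = (FreeGroup.lift g).comp φ := by
      ext i
      exact congrFun hfg i
    have h2 : FreeGroup.lift f = FreeGroup.lift g := by
      ext x
      obtain ⟨y, hy⟩ := hφ (FreeGroup.of x)
      rw [← hy]
      exact DFunLike.congr_fun h1 y
    exact FreeGroup.lift.injective h2
  have h2 := inj (Multiplicative (ZMod 2))
  have hfin : Finite (X → Multiplicative (ZMod 2)) := Finite.of_injective _ h2
  have hX : Finite X := by
    classical
    refine Finite.of_injective (fun x : X => (Pi.mulSingle x (Multiplicative.ofAdd 1) :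
      X → Multiplicative (ZMod 2))) ?_
    intro x y hxy
    by_contra hne
    have := congrFun hxy x
    simp [hne] at this
  refine ⟨hX, ?_, ?_⟩
  · have := Nat.card_le_card_of_injective _ h2
    rw [Nat.card_fun, Nat.card_fun] at this
    have h3 : 2 ^ Nat.card X ≤ 2 ^ m := by simpa using this
    exact (Nat.pow_le_pow_iff_right (by norm_num)).1 h3
  · intro hcard
    rw [injective_iff_map_eq_one]
    intro w hw
    by_contra hne
    obtain ⟨P, _, ψ, hψ⟩ := freeGroup_residual w hne
    have hb : Function.Bijective (fun f : X → Equiv.Perm P => fun i : Fin m =>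
        FreeGroup.lift f (φ (FreeGroup.of i))) := by
      rw [Nat.bijective_iff_injective_and_card]
      refine ⟨inj _, ?_⟩
      rw [Nat.card_fun, Nat.card_fun, hcard]; simp
    obtain ⟨f, hf⟩ := hb.2 (fun i => ψ (FreeGroup.of i))
    have : (FreeGroup.lift f).comp φ = ψ := by
      ext i : 1
      exact congrFun hf i
    apply hψ
    rw [← this, MonoidHom.comp_apply, hw, map_one]

theorem subgroupRank_le_iff {Γ : Type*} [Group Γ] (C : Subgroup Γ) (n : ℕ) :
    subgroupRank C ≤ n ↔ ∃ v : Fin n → Γ, (FreeGroup.lift v).range = C := by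
  classical
  constructor
  · intro h
    have : ∃ S : Finset Γ, Subgroup.closure (S : Set Γ) = C ∧ S.card ≤ n := by
      by_contra! hc
      have : ((n + 1 : ℕ) : ℕ∞) ≤ subgroupRank C := by
        refine le_iInf₂ fun S hS => ?_
        exact_mod_cast hc S hS
      have := this.trans h
      norm_cast at this
      omega
    obtain ⟨S, hS, hn⟩ := this
    refine ⟨fun i => if h : i.1 < S.card then (S.equivFin.symm ⟨i.1, h⟩ : Γ) else 1, ?_⟩
    rw [FreeGroup.range_lift_eq_closure, ← hS]
    apply le_antisymm
    · rw [Subgroup.closure_le]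
      rintro _ ⟨i, rfl⟩
      dsimp only
      split_ifs with h
      · exact Subgroup.subset_closure (S.equivFin.symm ⟨i.1, h⟩).2
      · exact one_mem _
    · apply Subgroup.closure_mono
      intro s hs
      have hlt := (S.equivFin ⟨s, hs⟩).2
      refine ⟨⟨(S.equivFin ⟨s, hs⟩).1, by omega⟩, ?_⟩
      simp
  · rintro ⟨v, rfl⟩
    refine (iInf₂_le (Finset.univ.image v) ?_).trans ?_
    · rw [FreeGroup.range_lift_eq_closure]; simp
    · exact_mod_cast Finset.card_image_le.trans (by simp)

theorem kfree_dichotomy {Γ : Type*} [Group Γ] {m : ℕ} (hk : KFree Γ m) (v : Fin m → Γ) :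
    Function.Injective (FreeGroup.lift v) ∨
      ∃ r < m, subgroupRank (FreeGroup.lift v).range ≤ (r : ℕ∞) := by
  have hfree := hk (FreeGroup.lift v).range ((subgroupRank_le_iff _ _).2 ⟨v, rfl⟩)
  let e := IsFreeGroup.toFreeGroup (FreeGroup.lift v).range
  obtain ⟨hX, hle, hinj⟩ := hopf_aux (e.toMonoidHom.comp (FreeGroup.lift v).rangeRestrict)
    (e.surjective.comp (FreeGroup.lift v).rangeRestrict_surjective)
  rcases hle.eq_or_lt with h | h
  · left
    intro a b hab
    apply hinj h
    have : (FreeGroup.lift v).rangeRestrict a = (FreeGroup.lift v).rangeRestrict b :=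
      Subtype.ext hab
    simp [this]
  · right
    refine ⟨_, h, (subgroupRank_le_iff _ _).2 ?_⟩
    have f := (Finite.equivFin (IsFreeGroup.Generators (FreeGroup.lift v).range)).symm
    refine ⟨fun i => (e.symm (FreeGroup.of (f i)) : Γ), ?_⟩
    let ψ : FreeGroup (Fin (Nat.card (IsFreeGroup.Generators (FreeGroup.lift v).range))) →* Γ :=
      (FreeGroup.lift v).range.subtype.comp
        (e.symm.toMonoidHom.comp (FreeGroup.freeGroupCongr f).toMonoidHom)
    have : FreeGroup.lift (fun i => (e.symm (FreeGroup.of (f i)) : Γ)) = ψ := by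
      ext i; simp [ψ]
    rw [this]
    ext y
    constructor
    · rintro ⟨z, rfl⟩
      exact Subtype.property _
    · intro hy
      refine ⟨(FreeGroup.freeGroupCongr f).symm (e ⟨y, hy⟩), ?_⟩
      change ((e.symm (FreeGroup.freeGroupCongr f
        ((FreeGroup.freeGroupCongr f).symm (e ⟨y, hy⟩))) : (FreeGroup.lift v).range) : Γ) = y
      rw [MulEquiv.apply_symm_apply, MulEquiv.symm_apply_apply]

theorem localRank_le_of {Γ : Type*} [Group Γ] (A : Subgroup Γ) {n : ℕ}
    (h : LocalRankLE A n) : localRank A ≤ n := iInf₂_le n h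

theorem LocalRankLE.mono {Γ : Type*} [Group Γ] {A : Subgroup Γ} {m n : ℕ}
    (h : LocalRankLE A m) (hmn : m ≤ n) : LocalRankLE A n := by
  intro B hB hfg
  obtain ⟨C, h1, h2, h3⟩ := h B hB hfg
  exact ⟨C, h1, h2, h3.trans (by exact_mod_cast hmn)⟩

theorem localRank_le_iff {Γ : Type*} [Group Γ] (A : Subgroup Γ) (n : ℕ) :
    localRank A ≤ n ↔ LocalRankLE A n := by
  refine ⟨fun h => ?_, fun h => iInf₂_le n h⟩
  by_contra hc
  have : ((n + 1 : ℕ) : ℕ∞) ≤ localRank A := by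
    refine le_iInf₂ fun r hr => ?_
    have : ¬ r ≤ n := fun hle => hc (hr.mono hle)
    exact_mod_cast (by omega : n + 1 ≤ r)
  have := this.trans h
  norm_cast at this
  omega

theorem kfree_of_le_iof {Γ : Type*} [Group Γ] {n : ℕ} (h : (n : ℕ∞) < iof Γ) :
    KFree Γ (n + 1) := by
  unfold iof at h
  obtain ⟨k, hk⟩ := lt_iSup_iff.1 h
  obtain ⟨hk1, hk2⟩ := lt_iSup_iff.1 hk
  intro H hH
  refine hk1 H (hH.trans ?_)
  norm_cast at hk2 ⊢

/-- The relation `⟨A, x⟩ → A` which is the identity on `A` and kills `x`. -/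
def relR {Γ : Type*} [Group Γ] (A : Subgroup Γ) (x : Γ) : Subgroup (Γ × Γ) :=
  A.map ((MonoidHom.id Γ).prod (MonoidHom.id Γ)) ⊔ Subgroup.closure {(x, 1)}

/-- `x` is dependent on `A`. -/
def Dep {Γ : Type*} [Group Γ] (A : Subgroup Γ) (x : Γ) : Prop :=
  x = 1 ∨ ∃ g ≠ 1, ((1 : Γ), g) ∈ relR A x

theorem relR_mono {Γ : Type*} [Group Γ] {A B : Subgroup Γ} (h : A ≤ B) (x : Γ) :
    relR A x ≤ relR B x :=
  sup_le_sup_right (Subgroup.map_mono h) _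

theorem Dep.mono {Γ : Type*} [Group Γ] {A B : Subgroup Γ} (h : A ≤ B) {x : Γ}
    (hd : Dep A x) : Dep B x :=
  hd.imp id fun ⟨g, hg, hm⟩ => ⟨g, hg, relR_mono h x hm⟩

theorem diag_mem_relR {Γ : Type*} [Group Γ] {A : Subgroup Γ} {a : Γ} (x : Γ) (h : a ∈ A) :
    (a, a) ∈ relR A x :=
  (le_sup_left : _ ≤ relR A x) ⟨a, h, rfl⟩

theorem self_mem_relR {Γ : Type*} [Group Γ] (A : Subgroup Γ) (x : Γ) :
    (x, 1) ∈ relR A x :=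
  (le_sup_right : _ ≤ relR A x) (Subgroup.subset_closure rfl)

theorem relR_le {Γ : Type*} [Group Γ] {A : Subgroup Γ} {x : Γ} {K : Subgroup (Γ × Γ)}
    (h1 : ∀ a ∈ A, (a, a) ∈ K) (h2 : (x, 1) ∈ K) : relR A x ≤ K := by
  refine sup_le ?_ ?_
  · rintro _ ⟨a, ha, rfl⟩
    exact h1 a ha
  · rw [Subgroup.closure_le]
    rintro _ rfl
    exact h2

theorem relR_snd {Γ : Type*} [Group Γ] {A : Subgroup Γ} {x : Γ} {p : Γ × Γ}
    (hp : p ∈ relR A x) : p.2 ∈ A :=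
  relR_le (K := A.comap (MonoidHom.snd Γ Γ)) (fun _ ha => ha) (one_mem A) hp

theorem relR_fst {Γ : Type*} [Group Γ] {A : Subgroup Γ} {x : Γ} {d : Γ}
    (hd : d ∈ A ⊔ Subgroup.closure {x}) : ∃ g, (d, g) ∈ relR A x := by
  have : A ⊔ Subgroup.closure {x} ≤ (relR A x).map (MonoidHom.fst Γ Γ) := by
    refine sup_le (fun a ha => ⟨_, diag_mem_relR x ha, rfl⟩) ?_
    rw [Subgroup.closure_le]
    rintro _ rfl
    exact ⟨_, self_mem_relR A _, rfl⟩
  obtain ⟨p, hp, rfl⟩ := this hd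
  exact ⟨p.2, hp⟩

/-- Elements of `relR A x` involve finitely many elements of `A`. -/
theorem relR_finite {Γ : Type*} [Group Γ] {A : Subgroup Γ} {x : Γ} {p : Γ × Γ}
    (hp : p ∈ relR A x) : ∃ B : Subgroup Γ, B ≤ A ∧ B.FG ∧ p ∈ relR B x := by
  let K : Subgroup (Γ × Γ) :=
    { carrier := {p | ∃ B : Subgroup Γ, B ≤ A ∧ B.FG ∧ p ∈ relR B x}
      mul_mem' := by
        rintro a b ⟨B, h1, h2, h3⟩ ⟨C, h4, h5, h6⟩
        exact ⟨B ⊔ C, sup_le h1 h4, h2.sup h5,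
          mul_mem (relR_mono le_sup_left x h3) (relR_mono le_sup_right x h6)⟩
      one_mem' := ⟨⊥, bot_le, Subgroup.FG.bot, one_mem _⟩
      inv_mem' := by
        rintro a ⟨B, h1, h2, h3⟩
        exact ⟨B, h1, h2, inv_mem h3⟩ }
  refine relR_le (K := K) ?_ ?_ hp
  · intro a ha
    exact ⟨Subgroup.closure {a}, by simpa [Subgroup.closure_le] using ha, ⟨{a}, by simp⟩,
      diag_mem_relR x (Subgroup.subset_closure rfl)⟩
  · exact ⟨⊥, bot_le, Subgroup.FG.bot, self_mem_relR _ _⟩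

theorem fg_le_sup {Γ : Type*} [Group Γ] {A : Subgroup Γ} {x : Γ} {D : Subgroup Γ} (hD : D.FG)
    (hle : D ≤ A ⊔ Subgroup.closure {x}) :
    ∃ B : Subgroup Γ, B ≤ A ∧ B.FG ∧ D ≤ B ⊔ Subgroup.closure {x} := by
  classical
  obtain ⟨S, rfl⟩ := hD
  induction S using Finset.induction_on with
  | empty => exact ⟨⊥, bot_le, Subgroup.FG.bot, by simp⟩
  | insert s S _ ih =>
    rw [Subgroup.closure_le, Finset.coe_insert, Set.insert_subset_iff] at hle
    obtain ⟨B, h1, h2, h3⟩ := ih ((Subgroup.closure_le _).2 hle.2)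
    obtain ⟨g, hg⟩ := relR_fst hle.1
    obtain ⟨C, h4, h5, h6⟩ := relR_finite hg
    have hs : s ∈ C ⊔ Subgroup.closure {x} :=
      relR_le (K := (C ⊔ Subgroup.closure {x}).comap (MonoidHom.fst Γ Γ))
        (fun a ha => (le_sup_left : C ≤ _) ha)
        ((le_sup_right : _ ≤ C ⊔ Subgroup.closure {x}) (Subgroup.subset_closure rfl)) h6
    refine ⟨B ⊔ C, sup_le h1 h4, h2.sup h5, ?_⟩
    rw [Subgroup.closure_le, Finset.coe_insert, Set.insert_subset_iff]
    have hle2 : C ⊔ Subgroup.closure {x} ≤ B ⊔ C ⊔ Subgroup.closure {x} :=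
      sup_le_sup_right le_sup_right _
    refine ⟨hle2 hs, ?_⟩
    rw [← Subgroup.closure_le]
    exact h3.trans (sup_le_sup_right le_sup_left _)

theorem admissible_of_dep {Γ : Type*} [Group Γ] {A : Subgroup Γ} {x : Γ}
    (hA : StronglyClosable A) (hd : Dep A x) : Admissible A x := by
  suffices h : localRank (A ⊔ Subgroup.closure {x}) ≤ localRank A from ⟨h.trans_lt hA, h⟩
  rcases hd with rfl | ⟨g, hg, hm⟩
  · rw [Subgroup.closure_singleton_one, sup_bot_eq]
  obtain ⟨n, hn⟩ := ENat.ne_top_iff_exists.1 (ne_top_of_lt hA)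
  have hlr : LocalRankLE A n := (localRank_le_iff A n).1 hn.ge
  have hk : KFree Γ (n + 1) := kfree_of_le_iof (by rw [hn]; exact hA)
  rw [← hn, localRank_le_iff]
  intro D hD hfg
  obtain ⟨B, hB1, hB2, hB3⟩ := fg_le_sup hfg hD
  obtain ⟨B', hB'1, hB'2, hB'3⟩ := relR_finite hm
  obtain ⟨C, hC1, hC2, hC3⟩ := hlr (B ⊔ B') (sup_le hB1 hB'1) (hB2.sup hB'2)
  obtain ⟨v, rfl⟩ := (subgroupRank_le_iff C n).1 hC3
  have hrange : (FreeGroup.lift (Fin.cons x v : Fin (n + 1) → Γ)).range =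
      (FreeGroup.lift v).range ⊔ Subgroup.closure {x} := by
    simp only [FreeGroup.range_lift_eq_closure]
    rw [← Subgroup.closure_union, Fin.range_cons, Set.union_comm, Set.insert_eq]
  refine ⟨(FreeGroup.lift v).range ⊔ Subgroup.closure {x}, sup_le_sup_right hC1 _,
    hB3.trans (sup_le_sup_right (le_sup_left.trans hC2) _), ?_⟩
  rw [← hrange]
  rcases kfree_dichotomy hk (Fin.cons x v : Fin (n + 1) → Γ) with h | ⟨r, hr, h⟩
  · exfalso
    have h1 := relR_mono (le_sup_right.trans hC2) x hB'3
    let ψ : FreeGroup (Fin (n + 1)) →* Γ × Γ :=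
      (FreeGroup.lift (Fin.cons x v : Fin (n + 1) → Γ)).prod
        (FreeGroup.lift (Fin.cons 1 v : Fin (n + 1) → Γ))
    have h2 : relR (FreeGroup.lift v).range x ≤ ψ.range := by
      refine relR_le ?_ ⟨FreeGroup.of 0, by simp [ψ]⟩
      have : (FreeGroup.lift v).range ≤
          ψ.range.comap ((MonoidHom.id Γ).prod (MonoidHom.id Γ)) := by
        rw [FreeGroup.range_lift_eq_closure, Subgroup.closure_le]
        rintro _ ⟨i, rfl⟩
        exact ⟨FreeGroup.of i.succ, by simp [ψ]⟩
      exact this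
    obtain ⟨w, hw⟩ := h2 h1
    have hw1 : FreeGroup.lift (Fin.cons x v : Fin (n + 1) → Γ) w = 1 := congrArg Prod.fst hw
    have hw2 : FreeGroup.lift (Fin.cons 1 v : Fin (n + 1) → Γ) w = g := congrArg Prod.snd hw
    have : w = 1 := h (by rw [hw1, map_one])
    rw [this, map_one] at hw2
    exact hg hw2.symm
  · exact h.trans (by exact_mod_cast (by omega : r ≤ n))

theorem dep_of_admissible {Γ : Type*} [Group Γ] {A : Subgroup Γ} {x : Γ}
    (h : Admissible A x) : Dep A x := by
  by_contra hnd
  unfold Dep at hnd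
  push Not at hnd
  obtain ⟨hx1, hfun⟩ := hnd
  have huniq : ∀ d g g', (d, g) ∈ relR A x → (d, g') ∈ relR A x → g = g' := by
    intro d g g' h1 h2
    by_contra hne
    refine hfun (g⁻¹ * g') (fun h => hne (inv_mul_eq_one.1 h)) ?_
    simpa using mul_mem (inv_mem h1) h2
  obtain ⟨hsc, hle⟩ := h
  obtain ⟨n, hn⟩ := ENat.ne_top_iff_exists.1 (ne_top_of_lt hsc)
  have hlr := (localRank_le_iff _ n).1 hn.ge
  have hk : KFree Γ (n + 1) := kfree_of_le_iof (by rw [hn]; exact hsc)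
  have hkn : KFree Γ n := fun H hH => hk H (hH.trans (by norm_cast; omega))
  obtain ⟨A₀, hA₀, hA₀fg, hmin⟩ : ∃ A₀ : Subgroup Γ, A₀ ≤ A ∧ A₀.FG ∧
      ∀ C ≤ A, A₀ ≤ C → ∀ r < n, ¬ subgroupRank C ≤ (r : ℕ∞) := by
    rcases Nat.eq_zero_or_pos n with rfl | hpos
    · exact ⟨⊥, bot_le, Subgroup.FG.bot, fun _ _ _ r hr => absurd hr (by omega)⟩
    · have : ¬ LocalRankLE A (n - 1) := by
        rw [← localRank_le_iff]
        intro hc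
        have := hle.trans hc
        rw [← hn] at this
        norm_cast at this
        omega
      unfold LocalRankLE at this
      push Not at this
      obtain ⟨B, hB, hBfg, hB'⟩ := this
      refine ⟨B, hB, hBfg, fun C hC hBC r hr hrk => ?_⟩
      refine absurd (hrk.trans ?_) (not_le.2 (hB' C hC hBC))
      exact_mod_cast (by omega : r ≤ n - 1)
  obtain ⟨C, hC1, hC2, hC3⟩ := hlr (A₀ ⊔ Subgroup.closure {x}) (sup_le_sup_right hA₀ _)
    (hA₀fg.sup ⟨{x}, by simp⟩)
  obtain ⟨v, rfl⟩ := (subgroupRank_le_iff C n).1 hC3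
  have hv : ∀ i, ∃ g, (v i, g) ∈ relR A x := fun i =>
    relR_fst (hC1 ⟨FreeGroup.of i, by simp⟩)
  choose u hu using hv
  have hrel : ∀ w, (FreeGroup.lift v w, FreeGroup.lift u w) ∈ relR A x := by
    have : ((FreeGroup.lift v).prod (FreeGroup.lift u)).range ≤ relR A x := by
      have e : (FreeGroup.lift v).prod (FreeGroup.lift u) =
          FreeGroup.lift (fun i => (v i, u i)) := by
        ext i <;> simp
      rw [e, FreeGroup.range_lift_eq_closure, Subgroup.closure_le]
      rintro _ ⟨i, rfl⟩
      exact hu i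
    exact fun w => this ⟨w, rfl⟩
  have hinj : Function.Injective (FreeGroup.lift u) := by
    rcases kfree_dichotomy hkn u with h | ⟨r, hr, h⟩
    · exact h
    · refine absurd h (hmin _ ?_ ?_ r hr)
      · rintro _ ⟨w, rfl⟩
        exact relR_snd (hrel w)
      · intro a ha
        obtain ⟨w, hw⟩ := hC2 ((le_sup_left : A₀ ≤ _) ha)
        refine ⟨w, huniq a _ _ ?_ (diag_mem_relR x (hA₀ ha))⟩
        have := hrel w
        rwa [hw] at this
  obtain ⟨w, hw⟩ := hC2 ((le_sup_right : _ ≤ A₀ ⊔ Subgroup.closure {x})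
    (Subgroup.subset_closure (Set.mem_singleton x)))
  have h1 := hrel w
  rw [hw] at h1
  have h2 : FreeGroup.lift u w = 1 := huniq _ _ _ h1 (self_mem_relR A x)
  have h3 : w = 1 := hinj (by rw [h2, map_one])
  rw [h3, map_one] at hw
  exact hx1 hw.symm

/-- The subgroup `⟨A, x₁, …, x_m⟩`. -/
def adjoinList {Γ : Type*} [Group Γ] : Subgroup Γ → List Γ → Subgroup Γ
  | A, [] => A
  | A, x :: xs => adjoinList (A ⊔ Subgroup.closure {x}) xs

theorem le_adjoinList {Γ : Type*} [Group Γ] (l : List Γ) (A : Subgroup Γ) :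
    A ≤ adjoinList A l := by
  induction l generalizing A with
  | nil => exact le_rfl
  | cons x xs ih => exact le_sup_left.trans (ih _)

theorem mem_adjoinList {Γ : Type*} [Group Γ] (l : List Γ) (A : Subgroup Γ) :
    ∀ x ∈ l, x ∈ adjoinList A l := by
  induction l generalizing A with
  | nil => simp
  | cons y xs ih =>
    intro x hx
    rcases List.mem_cons.1 hx with rfl | hx
    · exact le_adjoinList xs _
        ((le_sup_right : _ ≤ A ⊔ Subgroup.closure {x}) (Subgroup.subset_closure rfl))
    · exact ih _ x hx

theorem admissibleSeq_append {Γ : Type*} [Group Γ] (l l' : List Γ) (A : Subgroup Γ) :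
    AdmissibleSeq A (l ++ l') ↔ AdmissibleSeq A l ∧ AdmissibleSeq (adjoinList A l) l' := by
  induction l generalizing A with
  | nil => simp [AdmissibleSeq, adjoinList]
  | cons x xs ih => simp [AdmissibleSeq, adjoinList, ih, and_assoc]

theorem AdmissibleSeq.mono {Γ : Type*} [Group Γ] {l : List Γ} {A A' : Subgroup Γ}
    (h : AdmissibleSeq A l) (hle : A ≤ A') (hA' : StronglyClosable A') :
    AdmissibleSeq A' l := by
  induction l generalizing A A' with
  | nil => trivial
  | cons x xs ih =>
    have hadm := admissible_of_dep hA' ((dep_of_admissible h.1).mono hle)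
    exact ⟨hadm, ih h.2 (sup_le_sup_right hle _) hadm.1⟩

theorem AdmissibleSeq.stronglyClosable {Γ : Type*} [Group Γ] {l : List Γ} {A : Subgroup Γ}
    (h : AdmissibleSeq A l) (hl : l ≠ [] ∨ StronglyClosable A) :
    StronglyClosable (adjoinList A l) := by
  induction l generalizing A with
  | nil => simpa [adjoinList] using hl
  | cons x xs ih => exact ih h.2 (Or.inr h.1.1)

theorem exists_seq_of_finset {Γ : Type*} [Group Γ] {A H : Subgroup Γ}
    (hH : (H : Set Γ) = clo A) (S : Finset Γ) (hS : (S : Set Γ) ⊆ H) :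
    ∃ l : List Γ, l ≠ [] ∧ AdmissibleSeq A l ∧ ∀ s ∈ S, s ∈ l := by
  classical
  induction S using Finset.induction_on with
  | empty =>
    have : (1 : Γ) ∈ clo A := by rw [← hH]; exact one_mem H
    obtain ⟨l, hl⟩ := this
    exact ⟨l ++ [1], by simp, hl, by simp⟩
  | insert s S _ ih =>
    rw [Finset.coe_insert, Set.insert_subset_iff] at hS
    obtain ⟨l, h1, h2, h3⟩ := ih hS.2
    have : s ∈ clo A := by rw [← hH]; exact hS.1
    obtain ⟨l', hl'⟩ := this
    refine ⟨l ++ (l' ++ [s]), by simp, ?_, ?_⟩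
    · rw [admissibleSeq_append]
      exact ⟨h2, hl'.mono (le_adjoinList l A) (h2.stronglyClosable (Or.inl h1))⟩
    · intro t ht
      rcases Finset.mem_insert.1 ht with rfl | ht
      · simp
      · simp [h3 t ht]

/-- If `A` is a closable subgroup of `Γ` and `H` is the subgroup of `Γ` whose underlying
set is `clo A`, then every `H`-admissible element of `Γ` lies in `clo A`. -/
theorem cloAdmissible_mem_clo {Γ : Type*} [Group Γ] (A : Subgroup Γ) (hA : Closable A)
    (H : Subgroup Γ) (hH : (H : Set Γ) = clo A) (x : Γ) (hx : Admissible H x) :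
    x ∈ clo A := by
  have key : ∃ l : List Γ, l ≠ [] ∧ AdmissibleSeq A l ∧ Dep (adjoinList A l) x := by
    rcases dep_of_admissible hx with h1 | ⟨g, hg, hm⟩
    · obtain ⟨l, h2, h3, _⟩ := exists_seq_of_finset hH ∅ (by simp)
      exact ⟨l, h2, h3, Or.inl h1⟩
    · obtain ⟨B, hB, ⟨S, rfl⟩, hmB⟩ := relR_finite hm
      obtain ⟨l, h2, h3, h4⟩ := exists_seq_of_finset hH S ((Subgroup.closure_le H).1 hB)
      refine ⟨l, h2, h3, Or.inr ⟨g, hg, relR_mono ?_ x hmB⟩⟩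
      rw [Subgroup.closure_le]
      exact fun s hs => mem_adjoinList l A s (h4 s hs)
  obtain ⟨l, h1, h2, h3⟩ := key
  refine ⟨l, (admissibleSeq_append l [x] A).2 ⟨h2, ?_, trivial⟩⟩
  exact admissible_of_dep (h2.stronglyClosable (Or.inl h1)) h3
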